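/- The finite derivative test D satisfies the following strengthening of reasonableness: for all probability measures f, g on Ω^∞, every ε ∈ (0,1/2) and every measurable set A ⊆ Ω^∞, if g(A) > 0 and f(A) < (ε/(1−ε))·g(A), then there exists ε̄ ∈ (0,ε) such that g(A ∩ R_{D,ε̄}^{(f,g)}) > 0. -/

import Mathlib

open MeasureTheory Filter Set
open scoped ENNReal

/-- The space Ω^∞ of infinite binary sequences. -/
abbrev BinSeq : Type := ℕ → Bool

/-- The cylinder set `[ω^t]` of sequences agreeing with `ω` in the first `t` coordinates. -/
def cyl (ω : BinSeq) (t : ℕ) : Set BinSeq := {ω' | ∀ i < t, ω' i = ω i}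

/-- A (candidate) cardinal comparison test: to each ordered pair of measures, each time `t`
and each realization `ω` it assigns a number. -/
abbrev Test : Type := Measure BinSeq → Measure BinSeq → ℕ → BinSeq → ℝ

/-- The σ-algebra on `BinSeq` generated by the first `t` coordinates. -/
def coordAlg (t : ℕ) : MeasurableSpace BinSeq :=
  MeasurableSpace.comap (fun ω (i : Fin t) => ω (i : ℕ)) inferInstance

/-- A cardinal comparison test: values in `[0,1]`, and `T_t` is measurable with respect to the
σ-algebra generated by the first `t` coordinates, for every `t ≥ 1`. -/
def IsCCTest (T : Test) : Prop :=
  ∀ f g : Measure BinSeq, IsProbabilityMeasure f → IsProbabilityMeasure g →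
    ∀ t : ℕ, 1 ≤ t →
      (∀ ω, T f g t ω ∈ Set.Icc (0:ℝ) 1) ∧ @Measurable BinSeq ℝ (coordAlg t) _ (T f g t)

/-- `L_{T,ε}^{(f,g)}`: the set of `ω` where `lim_t T_t(ω,f,g)` exists and is `> ε`. -/
def LSet (T : Test) (f g : Measure BinSeq) (ε : ℝ) : Set BinSeq :=
  {ω | ∃ l : ℝ, Tendsto (fun t => T f g t ω) atTop (nhds l) ∧ ε < l}

/-- `R_{T,ε}^{(f,g)}`: the set of `ω` where `lim_t T_t(ω,f,g)` exists and is `< ε`. -/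
def RSet (T : Test) (f g : Measure BinSeq) (ε : ℝ) : Set BinSeq :=
  {ω | ∃ l : ℝ, Tendsto (fun t => T f g t ω) atTop (nhds l) ∧ l < ε}

/-- Anonymity: `T_t(ω,f,g) = 1 - T_t(ω,g,f)`. -/
def Anonymous (T : Test) : Prop :=
  ∀ f g : Measure BinSeq, IsProbabilityMeasure f → IsProbabilityMeasure g →
    ∀ t : ℕ, 1 ≤ t → ∀ ω, T f g t ω = 1 - T g f t ω

/-- Error-freeness. -/
def ErrorFree (T : Test) : Prop :=
  ∀ f g : Measure BinSeq, IsProbabilityMeasure f → IsProbabilityMeasure g →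
    ∀ A : Set BinSeq, MeasurableSet A →
      (∀ ε : ℝ, ε ∈ Set.Ioo 0 (1/2) →
        f (A ∩ RSet T f g ε) ≤ ENNReal.ofReal (ε / (1 - ε)) * g (A ∩ RSet T f g ε)) ∧
      (∀ ε : ℝ, ε ∈ Set.Ioo (1/2) 1 →
        g (A ∩ LSet T f g ε) ≤ ENNReal.ofReal ((1 - ε) / ε) * f (A ∩ LSet T f g ε))

/-- Reasonableness. -/
def Reasonable (T : Test) : Prop :=
  ∀ f g : Measure BinSeq, IsProbabilityMeasure f → IsProbabilityMeasure g →
    ∀ A : Set BinSeq, MeasurableSet A →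
      (∀ ε : ℝ, ε ∈ Set.Ioo 0 (1/2) →
        0 < g A → f A < ENNReal.ofReal (ε / (1 - ε)) * g A →
          0 < g (A ∩ RSet T f g ε)) ∧
      (∀ ε : ℝ, ε ∈ Set.Ioo (1/2) 1 →
        0 < f A → g A < ENNReal.ofReal ((1 - ε) / ε) * f A →
          0 < f (A ∩ LSet T f g ε))

/-- The finite derivative test `D`. -/
noncomputable def Dtest : Test := fun f g t ω =>
  match t with
  | 0 => 1/2
  | Nat.succ s =>
      if 0 < f (cyl ω s) + g (cyl ω s) then
        (f (cyl ω s)).toReal / ((f (cyl ω s)).toReal + (g (cyl ω s)).toReal)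
      else 1/2


/-- The projection of a binary sequence to its first `t` coordinates. -/
def initialSegment (t : ℕ) (ω : BinSeq) : Fin t → Bool := fun i => ω i

lemma measurable_initialSegment (t : ℕ) : Measurable (initialSegment t) :=
  measurable_pi_lambda _ fun i => measurable_pi_apply (i : ℕ)

lemma preimage_initialSegment_singleton (t : ℕ) (ω : BinSeq) :
    initialSegment t ⁻¹' {initialSegment t ω} = cyl ω t := by
  ext ω'
  simp only [mem_preimage, mem_singleton_iff, initialSegment, funext_iff, Fin.forall_iff, cyl,
    mem_ofPred_eq]

/-- The filtration generated by the coordinates of a binary sequence. -/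
def coordFiltration : Filtration ℕ (inferInstance : MeasurableSpace BinSeq) where
  seq := coordAlg
  mono' := by
    intro s t hst
    rw [coordAlg, ← measurable_iff_comap_le]
    refine @measurable_pi_lambda _ _ _ (coordAlg t) _ _ fun i => ?_
    have h := comap_measurable (m := inferInstance)
      (fun (ω : BinSeq) (j : Fin t) => ω (j : ℕ))
    exact (measurable_pi_apply (Fin.castLE hst i)).comp h
  le' t := (measurable_initialSegment t).comap_le

lemma iSup_coordFiltration :
    ⨆ t, coordFiltration t = (inferInstance : MeasurableSpace BinSeq) := by
  refine le_antisymm (iSup_le coordFiltration.le) ?_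
  refine iSup_le fun i => le_trans ?_ (le_iSup coordFiltration (i + 1))
  rw [← measurable_iff_comap_le]
  have h := comap_measurable (m := inferInstance)
    (fun (ω : BinSeq) (j : Fin (i + 1)) => ω (j : ℕ))
  exact (measurable_pi_apply (Fin.last i)).comp h

/-- The finite derivative test at time `t + 1` as a function of the first `t` coordinates. -/
noncomputable def segmentDerivative (f g : Measure BinSeq) (t : ℕ) (x : Fin t → Bool) : ℝ :=
  if 0 < f (initialSegment t ⁻¹' {x}) + g (initialSegment t ⁻¹' {x}) then
    (f (initialSegment t ⁻¹' {x})).toReal /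
      ((f (initialSegment t ⁻¹' {x})).toReal + (g (initialSegment t ⁻¹' {x})).toReal)
  else 1 / 2

lemma Dtest_succ (f g : Measure BinSeq) (t : ℕ) :
    Dtest f g (t + 1) = segmentDerivative f g t ∘ initialSegment t := by
  ext ω
  simp only [Dtest, Function.comp_apply, segmentDerivative, preimage_initialSegment_singleton]

lemma measureReal_mul_segmentDerivative (f g : Measure BinSeq) [IsFiniteMeasure f]
    [IsFiniteMeasure g] (t : ℕ) (x : Fin t → Bool) :
    (f + g).real (initialSegment t ⁻¹' {x}) * segmentDerivative f g t x =
      f.real (initialSegment t ⁻¹' {x}) := by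
  rw [measureReal_add_apply, segmentDerivative]
  split_ifs with h
  · refine mul_div_cancel₀ _ ?_
    change f.real _ + g.real _ ≠ 0
    rw [← measureReal_add_apply]
    exact (ENNReal.toReal_pos h.ne' (measure_ne_top (f + g) _)).ne'
  · obtain ⟨hf, hg⟩ := add_eq_zero.mp (not_lt.mp h |>.antisymm zero_le)
    simp [Measure.real, hf, hg]

lemma setIntegral_Dtest_succ (f g : Measure BinSeq) [IsFiniteMeasure f] [IsFiniteMeasure g]
    (t : ℕ) (S : Set (Fin t → Bool)) :
    ∫ ω in initialSegment t ⁻¹' S, Dtest f g (t + 1) ω ∂(f + g) =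
      f.real (initialSegment t ⁻¹' S) := by
  classical
  have hm := measurable_initialSegment t
  have hφ : Measurable (segmentDerivative f g t) := measurable_of_finite _
  obtain ⟨S, rfl⟩ : ∃ F : Finset (Fin t → Bool), S = F := ⟨S.toFinset, S.coe_toFinset.symm⟩
  have hmap : f.real (initialSegment t ⁻¹' S) =
      ∑ x ∈ S, (f.map (initialSegment t)).real {x} := by
    rw [sum_measureReal_singleton, map_measureReal_apply hm S.measurableSet]
  rw [Dtest_succ, hmap]
  simp only [Function.comp_apply]
  rw [← setIntegral_map S.measurableSet hφ.aestronglyMeasurable hm.aemeasurable,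
    setIntegral_finset S Integrable.of_finite.integrableOn]
  refine Finset.sum_congr rfl fun x _ => ?_
  rw [map_measureReal_apply hm (measurableSet_singleton x),
    map_measureReal_apply hm (measurableSet_singleton x), smul_eq_mul,
    measureReal_mul_segmentDerivative]

lemma absolutelyContinuous_add (f g : Measure BinSeq) : f ≪ f + g :=
  Measure.absolutelyContinuous_of_le (Measure.le_add_right le_rfl)

lemma Dtest_succ_ae_eq_condExp (f g : Measure BinSeq) [IsFiniteMeasure f] [IsFiniteMeasure g]
    (t : ℕ) :
    Dtest f g (t + 1) =ᵐ[f + g]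
      (f + g)[fun ω => (f.rnDeriv (f + g) ω).toReal | coordFiltration t] := by
  have hm := measurable_initialSegment t
  have hmeas : StronglyMeasurable[coordFiltration t] (Dtest f g (t + 1)) := by
    rw [Dtest_succ]
    exact ((measurable_of_finite (segmentDerivative f g t)).comp
      (comap_measurable (m := inferInstance) _)).stronglyMeasurable
  have hint : Integrable (Dtest f g (t + 1)) (f + g) := by
    rw [Dtest_succ]
    exact (Integrable.of_finite (μ := (f + g).map (initialSegment t))).comp_measurable hm
  refine ae_eq_condExp_of_forall_setIntegral_eq (coordFiltration.le t)
    Measure.integrable_toReal_rnDeriv (fun s _ _ => hint.integrableOn) ?_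
    hmeas.aestronglyMeasurable
  rintro _ ⟨S, -, rfl⟩ -
  rw [Measure.setIntegral_toReal_rnDeriv (absolutelyContinuous_add f g)]
  exact setIntegral_Dtest_succ f g t S

/-- The finite derivative test converges almost everywhere to the derivative of `f` with respect
to `f + g`. -/
lemma ae_tendsto_Dtest (f g : Measure BinSeq) [IsFiniteMeasure f] [IsFiniteMeasure g] :
    ∀ᵐ ω ∂(f + g), Tendsto (fun t => Dtest f g t ω) atTop
      (nhds (f.rnDeriv (f + g) ω).toReal) := by
  have hlevy := tendsto_ae_condExp (μ := f + g) (ℱ := coordFiltration)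
    (fun ω => (f.rnDeriv (f + g) ω).toReal)
  rw [iSup_coordFiltration, condExp_of_stronglyMeasurable le_rfl
    (Measure.measurable_rnDeriv f (f + g)).ennreal_toReal.stronglyMeasurable
    Measure.integrable_toReal_rnDeriv] at hlevy
  filter_upwards [hlevy, ae_all_iff.mpr (Dtest_succ_ae_eq_condExp f g)] with ω hω heq
  rw [← tendsto_add_atTop_iff_nat 1]
  simpa only [heq] using hω

/-- If the derivative of `f` with respect to `f + g` is at least `ε < 1` at `g`-almost every point
of `A`, then `ε / (1 - ε) * g A ≤ f A`. -/
lemma mul_measure_le_of_le_rnDeriv (f g : Measure BinSeq) [IsFiniteMeasure f] [IsFiniteMeasure g]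
    {ε : ℝ} (hε₀ : 0 ≤ ε) (hε₁ : ε < 1) {A : Set BinSeq} (hA : MeasurableSet A)
    (h : g (A ∩ {ω | (f.rnDeriv (f + g) ω).toReal < ε}) = 0) :
    ENNReal.ofReal (ε / (1 - ε)) * g A ≤ f A := by
  set d : BinSeq → ℝ := fun ω => (f.rnDeriv (f + g) ω).toReal with hd
  have hdm : Measurable d := (Measure.measurable_rnDeriv f (f + g)).ennreal_toReal
  have hdi : Integrable d (f + g) := Measure.integrable_toReal_rnDeriv
  have hset (s : Set BinSeq) : ∫ ω in s, d ω ∂(f + g) = f.real s :=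
    Measure.setIntegral_toReal_rnDeriv (absolutelyContinuous_add f g) s
  set B := A ∩ {ω | d ω < ε} with hB
  have hBm : MeasurableSet B := hA.inter (measurableSet_lt hdm measurable_const)
  have hgB : g.real B = 0 := by simp [Measure.real, h]
  have hfB : f.real B = 0 := by
    have hle : f.real B ≤ ε * f.real B := by
      have := setIntegral_mono_on hdi.integrableOn (integrable_const ε).integrableOn hBm
        fun ω hω => hω.2.le
      rw [hset, setIntegral_const, measureReal_add_apply, hgB, add_zero, smul_eq_mul] at this
      linarith
    nlinarith [measureReal_nonneg (μ := f) (s := B)]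
  have hae : ∀ᵐ ω ∂(f + g).restrict A, ε ≤ d ω := by
    rw [ae_restrict_iff' hA, ae_iff]
    have hB₀ : (f + g).real B = 0 := by rw [measureReal_add_apply, hfB, hgB, add_zero]
    rw [measureReal_eq_zero_iff] at hB₀
    convert hB₀ using 2
    ext ω
    simp [hB]
  have hfA : ε * (f.real A + g.real A) ≤ f.real A := by
    have := integral_mono_ae (integrable_const ε) hdi.integrableOn hae
    rw [hset, setIntegral_const, measureReal_add_apply, smul_eq_mul] at this
    linarith
  have hreal : ε / (1 - ε) * g.real A ≤ f.real A := by
    rw [div_mul_eq_mul_div, div_le_iff₀ (by linarith)]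
    linarith
  rw [← ofReal_measureReal (μ := g), ← ofReal_measureReal (μ := f),
    ← ENNReal.ofReal_mul (div_nonneg hε₀ (by linarith))]
  exact ENNReal.ofReal_le_ofReal hreal

/-- Strengthened reasonableness of the finite derivative test. -/
theorem stmt4 (f g : Measure BinSeq)
    [IsProbabilityMeasure f] [IsProbabilityMeasure g]
    (ε : ℝ) (hε : ε ∈ Set.Ioo 0 (1/2)) (A : Set BinSeq) (hA : MeasurableSet A)
    (hgA : 0 < g A) (hfA : f A < ENNReal.ofReal (ε / (1 - ε)) * g A) :
    ∃ ε' : ℝ, ε' ∈ Set.Ioo 0 ε ∧ 0 < g (A ∩ RSet Dtest f g ε') := by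
  by_contra! hcon
  refine hfA.not_ge (mul_measure_le_of_le_rnDeriv f g hε.1.le (by linarith [hε.2]) hA ?_)
  have hlim : ∀ᵐ ω ∂g, Tendsto (fun t => Dtest f g t ω) atTop
      (nhds (f.rnDeriv (f + g) ω).toReal) :=
    Measure.absolutelyContinuous_of_le (Measure.le_add_left le_rfl) (ae_tendsto_Dtest f g)
  obtain ⟨u, -, hu, hu_lim⟩ := exists_seq_strictMono_tendsto' hε.1
  have hnull : ∀ᵐ ω ∂g, ∀ n, ω ∉ A ∩ RSet Dtest f g (u n) :=
    ae_all_iff.mpr fun n => measure_eq_zero_iff_ae_notMem.mp (nonpos_iff_eq_zero.mp (hcon _ (hu n)))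
  refine measure_eq_zero_iff_ae_notMem.mpr ?_
  filter_upwards [hlim, hnull] with ω hω hnot hmem
  obtain ⟨n, hn⟩ := (hu_lim.eventually (lt_mem_nhds hmem.2)).exists
  exact hnot n ⟨hmem.1, _, hω, hn⟩
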